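/- arXiv:2109.04412 — 2 statements merged into one kernel-verified Lean document; each statement's English description precedes it below -/
import Mathlib

section
/- Let j₁, j₂, H₁, H₂ : ℝ⁴ → ℂ with j₁ and j₂ spacelike separated, suppose the support of H₁ is contained in the past causal cone {z ∈ ℝ⁴ | Q(z) ≥ 0, z₀ ≤ 0} and the support of H₂ is contained in the future causal cone {z ∈ ℝ⁴ | Q(z) ≥ 0, z₀ ≥ 0}. Then (j₁ ⋆ H₁)(x)·(j₂ ⋆ H₂)(x) = 0 for every x ∈ ℝ⁴. -/
open MeasureTheory

/-- The Minkowski quadratic form on `ℝ⁴`. -/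
def minkowskiQ (x : Fin 4 → ℝ) : ℝ := x 0 ^ 2 - x 1 ^ 2 - x 2 ^ 2 - x 3 ^ 2

/-- Two functions on Minkowski space are spacelike separated if every point of the
support of the first is at spacelike separation from every point of the support of
the second. -/
def SpacelikeSeparated (j₁ j₂ : (Fin 4 → ℝ) → ℂ) : Prop :=
  ∀ x ∈ Function.support j₁, ∀ y ∈ Function.support j₂, minkowskiQ (x - y) < 0

/-- Convolution of a source function with a propagator, with respect to Lebesgue
measure on `ℝ⁴`: `(j ⋆ H)(x) = ∫ j(y) H(x − y) dy`. -/
noncomputable def sourceConv (j H : (Fin 4 → ℝ) → ℂ) (x : Fin 4 → ℝ) : ℂ :=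
  ∫ y, j y * H (x - y)

/-- The future causal cone is closed under addition. -/
theorem minkowskiQ_add_nonneg {a b : Fin 4 → ℝ} (ha : 0 ≤ minkowskiQ a) (ha0 : 0 ≤ a 0)
    (hb : 0 ≤ minkowskiQ b) (hb0 : 0 ≤ b 0) : 0 ≤ minkowskiQ (a + b) := by
  simp only [minkowskiQ, Pi.add_apply] at *
  have cauchy_schwarz : (a 1 * b 1 + a 2 * b 2 + a 3 * b 3) ^ 2 ≤
      (a 1 ^ 2 + a 2 ^ 2 + a 3 ^ 2) * (b 1 ^ 2 + b 2 ^ 2 + b 3 ^ 2) := by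
    linarith [sq_nonneg (a 1 * b 2 - a 2 * b 1), sq_nonneg (a 1 * b 3 - a 3 * b 1),
      sq_nonneg (a 2 * b 3 - a 3 * b 2)]
  have causal : (a 1 ^ 2 + a 2 ^ 2 + a 3 ^ 2) * (b 1 ^ 2 + b 2 ^ 2 + b 3 ^ 2) ≤
      a 0 ^ 2 * b 0 ^ 2 :=
    mul_le_mul (by linarith) (by linarith) (by positivity) (by positivity)
  have inner_le : a 1 * b 1 + a 2 * b 2 + a 3 * b 3 ≤ a 0 * b 0 :=
    le_of_abs_le <| abs_le_of_sq_le_sq (by rw [mul_pow]; exact cauchy_schwarz.trans causal) (mul_nonneg ha0 hb0)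
  linarith

/-- If a convolution is nonzero at `x`, then `x` is the sum of a point in the support of the
source and a point in the support of the propagator. -/
theorem exists_mem_support_of_sourceConv_ne_zero {j H : (Fin 4 → ℝ) → ℂ} {x : Fin 4 → ℝ}
    (h : sourceConv j H x ≠ 0) :
    ∃ y ∈ Function.support j, x - y ∈ Function.support H := by
  contrapose! h
  refine integral_eq_zero_of_ae (Filter.Eventually.of_forall fun y => ?_)
  by_cases hy : j y = 0
  · simp [hy]
  · simp [Function.notMem_support.mp (h y hy)]

/-- If `j₁` and `j₂` are spacelike separated, `H₁` has past-causal support and `H₂`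
has future-causal support, then `(j₁ ⋆ H₁) · (j₂ ⋆ H₂)` vanishes identically. -/
theorem conv_mul_conv_eq_zero (j₁ j₂ H₁ H₂ : (Fin 4 → ℝ) → ℂ)
    (hsep : SpacelikeSeparated j₁ j₂)
    (hH₁ : Function.support H₁ ⊆ {z : Fin 4 → ℝ | 0 ≤ minkowskiQ z ∧ z 0 ≤ 0})
    (hH₂ : Function.support H₂ ⊆ {z : Fin 4 → ℝ | 0 ≤ minkowskiQ z ∧ 0 ≤ z 0}) :
    ∀ x, sourceConv j₁ H₁ x * sourceConv j₂ H₂ x = 0 := by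
  intro x
  by_contra h
  obtain ⟨h₁, h₂⟩ := mul_ne_zero_iff.mp h
  obtain ⟨y₁, hy₁, hz₁⟩ := exists_mem_support_of_sourceConv_ne_zero h₁
  obtain ⟨y₂, hy₂, hz₂⟩ := exists_mem_support_of_sourceConv_ne_zero h₂
  obtain ⟨hQ₁, ht₁⟩ := hH₁ hz₁
  obtain ⟨hQ₂, ht₂⟩ := hH₂ hz₂
  have hQ₁' : 0 ≤ minkowskiQ (y₁ - x) := by
    simp only [minkowskiQ, Pi.sub_apply] at hQ₁ ⊢
    linarith
  have ht₁' : 0 ≤ (y₁ - x) 0 := by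
    simp only [Pi.sub_apply] at ht₁ ⊢
    linarith
  have hQ := minkowskiQ_add_nonneg hQ₁' ht₁' hQ₂ ht₂
  rw [sub_add_sub_cancel] at hQ
  exact (hsep y₁ hy₁ y₂ hy₂).not_ge hQ
end

section
/- Let j₁, j₂, j₃ : ℝ⁴ → ℂ be continuous with compact support and let H₁, H₂ : ℝ⁴ → ℂ be locally integrable, with the support of H₁ contained in the past causal cone {z | Q(z) ≥ 0, z₀ ≤ 0} and the support of H₂ contained in the future causal cone {z | Q(z) ≥ 0, z₀ ≥ 0}. Suppose j₁ and j₂ are spacelike separated. Then for F[j] = jⁿ·(j ⋆ H₁)·(j ⋆ H₂) and every natural number n, F[j₁+j₂+j₃](x) = F[j₁+j₃](x) + F[j₂+j₃](x) − F[j₃](x) for all x ∈ ℝ⁴. -/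
open MeasureTheory

theorem minkowskiQ_neg (z : Fin 4 → ℝ) : minkowskiQ (-z) = minkowskiQ z := by
  simp [minkowskiQ]

theorem minkowskiQ_sub_comm (x y : Fin 4 → ℝ) : minkowskiQ (x - y) = minkowskiQ (y - x) := by
  rw [← minkowskiQ_neg, neg_sub]

/-- The future causal cone is closed under addition. -/
theorem minkowskiQ_add_nonneg_s11 {u v : Fin 4 → ℝ} (hu : 0 ≤ minkowskiQ u) (hu₀ : 0 ≤ u 0)
    (hv : 0 ≤ minkowskiQ v) (hv₀ : 0 ≤ v 0) : 0 ≤ minkowskiQ (u + v) := by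
  simp only [minkowskiQ, Pi.add_apply] at *
  have hsq : (u 1 * v 1 + u 2 * v 2 + u 3 * v 3) ^ 2 ≤ (u 0 * v 0) ^ 2 := by
    have hmul : (u 1 ^ 2 + u 2 ^ 2 + u 3 ^ 2) * (v 1 ^ 2 + v 2 ^ 2 + v 3 ^ 2) ≤
        u 0 ^ 2 * v 0 ^ 2 :=
      mul_le_mul (by linarith) (by linarith) (by positivity) (by positivity)
    linarith [sq_nonneg (u 1 * v 2 - u 2 * v 1), sq_nonneg (u 1 * v 3 - u 3 * v 1),
      sq_nonneg (u 2 * v 3 - u 3 * v 2)]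
  have hle := abs_le_of_sq_le_sq hsq (mul_nonneg hu₀ hv₀)
  linarith [(abs_le.1 hle).2]

theorem SpacelikeSeparated.symm {j₁ j₂ : (Fin 4 → ℝ) → ℂ} (h : SpacelikeSeparated j₁ j₂) :
    SpacelikeSeparated j₂ j₁ := fun x hx y hy => by
  rw [minkowskiQ_sub_comm]
  exact h y hy x hx

theorem integrable_mul_comp_sub_left {j H : (Fin 4 → ℝ) → ℂ} (hjc : Continuous j)
    (hjs : HasCompactSupport j) (hH : LocallyIntegrable H) (x : Fin 4 → ℝ) :
    Integrable fun y => j y * H (x - y) :=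
  hjs.convolutionExists_left (ContinuousLinearMap.mul ℝ ℂ) hjc hH x

theorem sourceConv_add {j k H : (Fin 4 → ℝ) → ℂ} (hjc : Continuous j)
    (hjs : HasCompactSupport j) (hkc : Continuous k) (hks : HasCompactSupport k)
    (hH : LocallyIntegrable H) (x : Fin 4 → ℝ) :
    sourceConv (j + k) H x = sourceConv j H x + sourceConv k H x := by
  simp only [sourceConv, Pi.add_apply, add_mul]
  exact integral_add (integrable_mul_comp_sub_left hjc hjs hH x)
    (integrable_mul_comp_sub_left hkc hks hH x)

/-- Convolving with a causally supported propagator gives zero at points of the support of a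
spacelike separated source. -/
theorem SpacelikeSeparated.sourceConv_eq_zero {j k H : (Fin 4 → ℝ) → ℂ}
    (h : SpacelikeSeparated j k) (hH : ∀ z ∈ Function.support H, 0 ≤ minkowskiQ z)
    {x : Fin 4 → ℝ} (hx : j x ≠ 0) : sourceConv k H x = 0 := by
  by_contra hne
  obtain ⟨y, hy, hxy⟩ := exists_mem_support_of_sourceConv_ne_zero hne
  exact (h x hx y hy).not_ge (hH _ hxy)

/-- The advanced convolution of one source and the retarded convolution of a spacelike separated
one have disjoint supports. -/
theorem SpacelikeSeparated.sourceConv_mul_sourceConv_eq_zero {j k H₁ H₂ : (Fin 4 → ℝ) → ℂ}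
    (h : SpacelikeSeparated j k)
    (hH₁ : Function.support H₁ ⊆ {z : Fin 4 → ℝ | 0 ≤ minkowskiQ z ∧ z 0 ≤ 0})
    (hH₂ : Function.support H₂ ⊆ {z : Fin 4 → ℝ | 0 ≤ minkowskiQ z ∧ 0 ≤ z 0})
    (x : Fin 4 → ℝ) : sourceConv j H₁ x * sourceConv k H₂ x = 0 := by
  by_contra hne
  obtain ⟨y, hy, hxy⟩ := exists_mem_support_of_sourceConv_ne_zero (left_ne_zero_of_mul hne)
  obtain ⟨z, hz, hxz⟩ := exists_mem_support_of_sourceConv_ne_zero (right_ne_zero_of_mul hne)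
  obtain ⟨hQy, hy₀⟩ := hH₁ hxy
  obtain ⟨hQz, hz₀⟩ := hH₂ hxz
  rw [minkowskiQ_sub_comm] at hQy
  have hyx₀ : 0 ≤ (y - x) 0 := by
    simp only [Pi.sub_apply] at hy₀ ⊢
    linarith
  have hnonneg := minkowskiQ_add_nonneg_s11 hQy hyx₀ hQz hz₀
  rw [sub_add_sub_cancel] at hnonneg
  exact (h y hy z hz).not_ge hnonneg

/-- The source functional `F[j] = jⁿ·(j ⋆ H₁)·(j ⋆ H₂)` satisfies the
weakened-linearity axiom `F[j₁+j₂+j₃] = F[j₁+j₃] + F[j₂+j₃] − F[j₃]` pointwise, when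
`j₁` and `j₂` are spacelike separated, `H₁` is locally integrable with past-causal
support and `H₂` is locally integrable with future-causal support. -/
theorem pow_mul_conv_conv_weakened_linearity (j₁ j₂ j₃ H₁ H₂ : (Fin 4 → ℝ) → ℂ)
    (hj₁c : Continuous j₁) (hj₁s : HasCompactSupport j₁)
    (hj₂c : Continuous j₂) (hj₂s : HasCompactSupport j₂)
    (hj₃c : Continuous j₃) (hj₃s : HasCompactSupport j₃)
    (hH₁ : LocallyIntegrable H₁) (hH₂ : LocallyIntegrable H₂)
    (hH₁supp : Function.support H₁ ⊆ {z : Fin 4 → ℝ | 0 ≤ minkowskiQ z ∧ z 0 ≤ 0})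
    (hH₂supp : Function.support H₂ ⊆ {z : Fin 4 → ℝ | 0 ≤ minkowskiQ z ∧ 0 ≤ z 0})
    (hsep : SpacelikeSeparated j₁ j₂) (n : ℕ) :
    ∀ x : Fin 4 → ℝ,
      (j₁ x + j₂ x + j₃ x) ^ n * sourceConv (j₁ + j₂ + j₃) H₁ x *
          sourceConv (j₁ + j₂ + j₃) H₂ x =
        (j₁ x + j₃ x) ^ n * sourceConv (j₁ + j₃) H₁ x * sourceConv (j₁ + j₃) H₂ x +
          (j₂ x + j₃ x) ^ n * sourceConv (j₂ + j₃) H₁ x * sourceConv (j₂ + j₃) H₂ x -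
            j₃ x ^ n * sourceConv j₃ H₁ x * sourceConv j₃ H₂ x := by
  intro x
  have hQ₁ : ∀ z ∈ Function.support H₁, 0 ≤ minkowskiQ z := fun z hz => (hH₁supp hz).1
  have hQ₂ : ∀ z ∈ Function.support H₂, 0 ≤ minkowskiQ z := fun z hz => (hH₂supp hz).1
  have hcross := hsep.sourceConv_mul_sourceConv_eq_zero hH₁supp hH₂supp x
  have hcross' := hsep.symm.sourceConv_mul_sourceConv_eq_zero hH₁supp hH₂supp x
  rw [sourceConv_add (hj₁c.add hj₂c) (hj₁s.add hj₂s) hj₃c hj₃s hH₁,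
    sourceConv_add (hj₁c.add hj₂c) (hj₁s.add hj₂s) hj₃c hj₃s hH₂,
    sourceConv_add hj₁c hj₁s hj₂c hj₂s hH₁, sourceConv_add hj₁c hj₁s hj₂c hj₂s hH₂,
    sourceConv_add hj₁c hj₁s hj₃c hj₃s hH₁, sourceConv_add hj₁c hj₁s hj₃c hj₃s hH₂,
    sourceConv_add hj₂c hj₂s hj₃c hj₃s hH₁, sourceConv_add hj₂c hj₂s hj₃c hj₃s hH₂]
  by_cases h₁ : j₁ x = 0
  · by_cases h₂ : j₂ x = 0
    · simp only [h₁, h₂, zero_add]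
      linear_combination j₃ x ^ n * hcross + j₃ x ^ n * hcross'
    · rw [h₁, hsep.symm.sourceConv_eq_zero hQ₁ h₂, hsep.symm.sourceConv_eq_zero hQ₂ h₂]
      ring
  · have h₂ : j₂ x = 0 := by
      by_contra h₂
      simpa [minkowskiQ] using hsep x h₁ x h₂
    rw [h₂, hsep.sourceConv_eq_zero hQ₁ h₁, hsep.sourceConv_eq_zero hQ₂ h₁]
    ring
end
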